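/- Let Π be a finite projective plane of order q. If Π obeys the Fano axiom, then A_7(Π) = 30·C_4(Π); if Π does not obey the Fano axiom, then A_7(Π) < 30·C_4(Π). -/

import Mathlib

open scoped Classical

structure ProjPlane (q : ℕ) where
  Point : Type
  fintypePoint : Fintype Point
  L : Set (Set Point)
  unique_line : ∀ p₁ p₂ : Point, p₁ ≠ p₂ → ∃! ℓ, ℓ ∈ L ∧ p₁ ∈ ℓ ∧ p₂ ∈ ℓ
  unique_point : ∀ ℓ₁ ℓ₂, ℓ₁ ∈ L → ℓ₂ ∈ L → ℓ₁ ≠ ℓ₂ → ∃! p, p ∈ ℓ₁ ∧ p ∈ ℓ₂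
  nondegenerate : ∃ a b c d : Point, a ≠ b ∧ a ≠ c ∧ a ≠ d ∧ b ≠ c ∧ b ≠ d ∧ c ≠ d ∧
    ∀ ℓ ∈ L, ¬({a, b, c} ⊆ ℓ) ∧ ¬({a, b, d} ⊆ ℓ) ∧ ¬({a, c, d} ⊆ ℓ) ∧ ¬({b, c, d} ⊆ ℓ)
  line_card : ∀ ℓ ∈ L, ℓ.ncard = q + 1
  point_card : ∀ p : Point, {ℓ ∈ L | p ∈ ℓ}.ncard = q + 1

/-- A set of points is collinear if it is contained in a line. -/
noncomputable def ProjPlane.Collinear {q : ℕ} (Pl : ProjPlane q) (s : Set Pl.Point) : Prop :=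
  ∃ ℓ ∈ Pl.L, s ⊆ ℓ

/-- The number of ordered `n`-arcs of the plane. -/
noncomputable def ProjPlane.nArcs {q : ℕ} (Pl : ProjPlane q) (n : ℕ) : ℕ :=
  Nat.card {p : Fin n → Pl.Point // Function.Injective p ∧
    ∀ i j k : Fin n, i ≠ j → i ≠ k → j ≠ k → ¬ Pl.Collinear {p i, p j, p k}}

/-- Number of ordered strong realizations of the Fano plane. -/
noncomputable def ProjPlane.A7 {q : ℕ} (Pl : ProjPlane q) : ℕ :=
  Nat.card {p : ZMod 7 → Pl.Point // Function.Injective p ∧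
    ∃ σ : Equiv.Perm (ZMod 7), ∀ i j k : ZMod 7, i ≠ j → i ≠ k → j ≠ k →
      (Pl.Collinear {p (σ i), p (σ j), p (σ k)} ↔
        ∃ a : ZMod 7, ({i, j, k} : Set (ZMod 7)) = {a, a + 1, a + 3})}

/-- Number of ordered strong realizations of the Möbius–Kantor configuration. -/
noncomputable def ProjPlane.A8 {q : ℕ} (Pl : ProjPlane q) : ℕ :=
  Nat.card {p : ZMod 8 → Pl.Point // Function.Injective p ∧
    ∃ σ : Equiv.Perm (ZMod 8), ∀ i j k : ZMod 8, i ≠ j → i ≠ k → j ≠ k →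
      (Pl.Collinear {p (σ i), p (σ j), p (σ k)} ↔
        ∃ a : ZMod 8, ({i, j, k} : Set (ZMod 8)) = {a, a + 1, a + 3})}

/-- A projective plane obeys the Fano axiom if for every 4-arc `(a, b, c, d)`,
the three diagonal points `ab ∩ cd`, `ac ∩ bd`, `ad ∩ bc` lie on a common line. -/
def ProjPlane.FanoAxiom {q : ℕ} (Pl : ProjPlane q) : Prop :=
  ∀ a b c d : Pl.Point,
    a ≠ b → a ≠ c → a ≠ d → b ≠ c → b ≠ d → c ≠ d →
    ¬ Pl.Collinear {a, b, c} → ¬ Pl.Collinear {a, b, d} →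
    ¬ Pl.Collinear {a, c, d} → ¬ Pl.Collinear {b, c, d} →
    ∀ lab lcd lac lbd lad lbc : Set Pl.Point,
      lab ∈ Pl.L → a ∈ lab → b ∈ lab →
      lcd ∈ Pl.L → c ∈ lcd → d ∈ lcd →
      lac ∈ Pl.L → a ∈ lac → c ∈ lac →
      lbd ∈ Pl.L → b ∈ lbd → d ∈ lbd →
      lad ∈ Pl.L → a ∈ lad → d ∈ lad →
      lbc ∈ Pl.L → b ∈ lbc → c ∈ lbc →
      ∀ p₁ p₂ p₃ : Pl.Point,
        p₁ ∈ lab → p₁ ∈ lcd → p₂ ∈ lac → p₂ ∈ lbd → p₃ ∈ lad → p₃ ∈ lbc →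
        Pl.Collinear {p₁, p₂, p₃}

namespace ProjPlane

variable {q : ℕ} (Pl : ProjPlane q)

section Incidence

variable {Pl}

theorem eq_or_eq_of_mem {x y : Pl.Point} {l m : Set Pl.Point} (hl : l ∈ Pl.L) (hm : m ∈ Pl.L)
    (hxl : x ∈ l) (hyl : y ∈ l) (hxm : x ∈ m) (hym : y ∈ m) : x = y ∨ l = m := by
  by_cases h : x = y
  · exact .inl h
  · exact .inr ((Pl.unique_line x y h).unique ⟨hl, hxl, hyl⟩ ⟨hm, hxm, hym⟩)

theorem collinear_triple_iff {x y z : Pl.Point} :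
    Pl.Collinear {x, y, z} ↔ ∃ l ∈ Pl.L, x ∈ l ∧ y ∈ l ∧ z ∈ l := by
  simp [Collinear, Set.insert_subset_iff]

theorem exists_line {x y : Pl.Point} (h : x ≠ y) : ∃ l ∈ Pl.L, x ∈ l ∧ y ∈ l := by
  obtain ⟨l, ⟨h1, h2⟩, -⟩ := Pl.unique_line x y h
  exact ⟨l, h1, h2⟩

theorem exists_mem_inter {l m : Set Pl.Point} (hl : l ∈ Pl.L) (hm : m ∈ Pl.L) (h : l ≠ m) :
    ∃ x, x ∈ l ∧ x ∈ m :=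
  (Pl.unique_point l m hl hm h).exists

end Incidence

/-- The third point of the line of the Fano plane through `i` and `j` (and `i` itself if
`i = j`). -/
def fanoThird (i j : ZMod 7) : ZMod 7 := 4 * (i + j) - (i - j) ^ 4

theorem fano_line_iff {i j k : ZMod 7} (hij : i ≠ j) (hik : i ≠ k) (hjk : j ≠ k) :
    (∃ a : ZMod 7, ({i, j, k} : Set (ZMod 7)) = {a, a + 1, a + 3}) ↔ k = fanoThird i j := by
  have key : ∀ i j k : ZMod 7, i ≠ j → i ≠ k → j ≠ k →
      ((∃ a : ZMod 7, ({i, j, k} : Finset (ZMod 7)) = {a, a + 1, a + 3}) ↔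
        k = fanoThird i j) := by
    decide +kernel
  rw [← key i j k hij hik hjk]
  refine exists_congr fun a => ?_
  rw [← Finset.coe_inj]
  simp

/-- A labelled strong realization of the Fano plane. -/
def IsFano (r : ZMod 7 → Pl.Point) : Prop :=
  Function.Injective r ∧ ∀ i j k : ZMod 7, i ≠ j → i ≠ k → j ≠ k →
    (Pl.Collinear {r i, r j, r k} ↔ k = fanoThird i j)

/-- An automorphism of the Fano plane. -/
def IsFanoAut (σ : Equiv.Perm (ZMod 7)) : Prop :=
  ∀ i j : ZMod 7, σ (fanoThird i j) = fanoThird (σ i) (σ j)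

theorem fanoThird_ne_left : ∀ i j : ZMod 7, i ≠ j → i ≠ fanoThird i j := by
  decide +kernel

theorem fanoThird_ne_right : ∀ i j : ZMod 7, i ≠ j → j ≠ fanoThird i j := by
  decide +kernel

theorem fanoThird_self : ∀ i : ZMod 7, fanoThird i i = i := by
  decide +kernel

variable {Pl} in
theorem IsFano.comp_perm_iff {r : ZMod 7 → Pl.Point} (hr : Pl.IsFano r)
    (τ : Equiv.Perm (ZMod 7)) : Pl.IsFano (r ∘ τ) ↔ IsFanoAut τ := by
  have hτ {i j : ZMod 7} : τ i = τ j ↔ i = j := τ.injective.eq_iff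
  constructor
  · intro h i j
    by_cases hij : i = j
    · simp [hij, fanoThird_self]
    · have h1 := fanoThird_ne_left i j hij
      have h2 := fanoThird_ne_right i j hij
      exact (hr.2 (τ i) (τ j) (τ (fanoThird i j)) (by simpa) (by simpa) (by simpa)).1
        ((h.2 i j _ hij h1 h2).2 rfl)
  · intro h
    refine ⟨hr.1.comp τ.injective, fun i j k hij hik hjk => ?_⟩
    rw [← hτ, h i j]
    exact hr.2 (τ i) (τ j) (τ k) (by simpa) (by simpa) (by simpa)

/-- The map extending `0 ↦ x`, `1 ↦ y`, `2 ↦ z` to the Fano plane by means of `fanoThird`. -/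
def fanoExtend (x y z : ZMod 7) : ZMod 7 → ZMod 7 :=
  ![x, y, z, fanoThird x y, fanoThird y z, fanoThird z (fanoThird x y), fanoThird x z]

theorem fanoExtend_spec : ∀ x y z : ZMod 7, x ≠ y → x ≠ z → y ≠ z → z ≠ fanoThird x y →
    (∀ i j, fanoExtend x y z i = fanoExtend x y z j → i = j) ∧
    ∀ i j, fanoExtend x y z (fanoThird i j) =
      fanoThird (fanoExtend x y z i) (fanoExtend x y z j) := by
  decide +kernel

theorem IsFanoAut.eq_fanoExtend {σ : Equiv.Perm (ZMod 7)} (h : IsFanoAut σ) :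
    ⇑σ = fanoExtend (σ 0) (σ 1) (σ 2) := by
  have e3 : (3 : ZMod 7) = fanoThird 0 1 := by decide +kernel
  have e4 : (4 : ZMod 7) = fanoThird 1 2 := by decide +kernel
  have e5 : (5 : ZMod 7) = fanoThird 2 (fanoThird 0 1) := by decide +kernel
  have e6 : (6 : ZMod 7) = fanoThird 0 2 := by decide +kernel
  funext i
  have h3 : σ 3 = fanoThird (σ 0) (σ 1) := by rw [e3, h]
  have h4 : σ 4 = fanoThird (σ 1) (σ 2) := by rw [e4, h]
  have h5 : σ 5 = fanoThird (σ 2) (fanoThird (σ 0) (σ 1)) := by rw [e5, h, h]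
  have h6 : σ 6 = fanoThird (σ 0) (σ 2) := by rw [e6, h]
  fin_cases i
  exacts [rfl, rfl, rfl, h3, h4, h5, h6]

theorem card_isFanoAut : Nat.card {σ : Equiv.Perm (ZMod 7) // IsFanoAut σ} = 168 := by
  let T := {t : ZMod 7 × ZMod 7 × ZMod 7 //
    t.1 ≠ t.2.1 ∧ t.1 ≠ t.2.2 ∧ t.2.1 ≠ t.2.2 ∧ t.2.2 ≠ fanoThird t.1 t.2.1}
  have hT : Nat.card T = 168 := by
    rw [Nat.card_eq_fintype_card]
    decide +kernel
  rw [← hT]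
  refine Nat.card_eq_of_bijective (fun σ => ⟨(σ.1 0, σ.1 1, σ.1 2), ?_⟩) ⟨?_, ?_⟩
  · obtain ⟨σ, h⟩ := σ
    refine ⟨?_, ?_, ?_, ?_⟩ <;> simp only [← h 0 1, ne_eq, σ.injective.eq_iff] <;> decide +kernel
  · rintro ⟨σ, h⟩ ⟨τ, h'⟩ hστ
    have hστ := congrArg Subtype.val hστ
    simp only [Prod.mk.injEq] at hστ
    refine Subtype.ext (DFunLike.coe_injective ?_)
    simp only
    rw [h.eq_fanoExtend, h'.eq_fanoExtend, hστ.1, hστ.2.1, hστ.2.2]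
  · rintro ⟨⟨x, y, z⟩, h1, h2, h3, h4⟩
    obtain ⟨hinj, hthird⟩ := fanoExtend_spec x y z h1 h2 h3 h4
    exact ⟨⟨Equiv.ofBijective _ (Finite.injective_iff_bijective.1 fun i j => hinj i j), hthird⟩,
      rfl⟩

theorem A7_eq_card : Pl.A7 = Nat.card {p : ZMod 7 → Pl.Point //
    ∃ σ : Equiv.Perm (ZMod 7), Pl.IsFano (p ∘ σ)} := by
  refine Nat.card_congr (Equiv.subtypeEquivRight fun p => ?_)
  rw [← exists_and_left]
  refine exists_congr fun σ => and_congr (EquivLike.injective_comp σ p).symm ?_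
  refine forall₃_congr fun i j k => forall₃_congr fun hij hik hjk => ?_
  rw [fano_line_iff hij hik hjk]
  rfl

theorem A7_eq_thirty_mul : Pl.A7 = 30 * Nat.card {r : ZMod 7 → Pl.Point // Pl.IsFano r} := by
  let F := {r : ZMod 7 → Pl.Point // Pl.IsFano r}
  let A := {p : ZMod 7 → Pl.Point // ∃ σ : Equiv.Perm (ZMod 7), Pl.IsFano (p ∘ σ)}
  let G := {σ : Equiv.Perm (ZMod 7) // IsFanoAut σ}
  have hmem (p : A) (σ : Equiv.Perm (ZMod 7)) :
      Pl.IsFano (p.1 ∘ σ) ↔ IsFanoAut (p.2.choose⁻¹ * σ) := by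
    rw [← p.2.choose_spec.comp_perm_iff]
    refine iff_of_eq (congrArg _ (funext fun i => ?_))
    simp
  let e : F × Equiv.Perm (ZMod 7) ≃ A × G :=
    { toFun := fun x =>
        have h : Pl.IsFano ((x.1.1 ∘ ⇑x.2⁻¹) ∘ x.2) := by
          convert x.1.2; funext i; simp
        let p : A := ⟨x.1.1 ∘ ⇑x.2⁻¹, x.2, h⟩
        (p, ⟨p.2.choose⁻¹ * x.2, (hmem p x.2).1 h⟩)
      invFun := fun y =>
        (⟨y.1.1 ∘ ⇑(y.1.2.choose * y.2.1), (hmem _ _).2 (by simpa using y.2.2)⟩,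
          y.1.2.choose * y.2.1)
      left_inv := fun x => by
        ext i <;> simp
      right_inv := fun y => by
        have : (⟨(y.1.1 ∘ ⇑(y.1.2.choose * y.2.1)) ∘ ⇑(y.1.2.choose * y.2.1)⁻¹,
            y.1.2.choose * y.2.1, by
              convert (hmem y.1 (y.1.2.choose * y.2.1)).2 (by simpa using y.2.2)
              funext i; simp⟩ : A) = y.1 := by
          refine Subtype.ext (funext fun i => ?_)
          simp
        refine Prod.ext this (Subtype.ext ?_)
        simp only
        rw [← mul_assoc]
        convert one_mul _
        rw [inv_mul_eq_one]
        exact congrArg (fun a : A => a.2.choose) this }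
  have h := Nat.card_congr e
  rw [Nat.card_prod, Nat.card_prod, card_isFanoAut, Nat.card_perm, Nat.card_zmod,
    show Nat.factorial 7 = 5040 from rfl] at h
  have hA : Pl.A7 = Nat.card A := Pl.A7_eq_card
  have hF : Nat.card {r : ZMod 7 → Pl.Point // Pl.IsFano r} = Nat.card F := rfl
  omega

/-- A `4`-tuple in general position. -/
def IsArc4 (p : Fin 4 → Pl.Point) : Prop :=
  Function.Injective p ∧
    ∀ i j k : Fin 4, i ≠ j → i ≠ k → j ≠ k → ¬ Pl.Collinear {p i, p j, p k}

variable {Pl}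

theorem IsFano.isArc4 {r : ZMod 7 → Pl.Point} (hr : Pl.IsFano r) :
    Pl.IsArc4 (r ∘ ![2, 4, 5, 6]) := by
  have h1 : ∀ i j : Fin 4, (![2, 4, 5, 6] : Fin 4 → ZMod 7) i = ![2, 4, 5, 6] j → i = j := by
    decide +kernel
  have h2 : ∀ i j k : Fin 4, i ≠ j → i ≠ k → j ≠ k →
      (![2, 4, 5, 6] : Fin 4 → ZMod 7) k ≠ fanoThird (![2, 4, 5, 6] i) (![2, 4, 5, 6] j) := by
    decide +kernel
  refine ⟨hr.1.comp fun i j => h1 i j, fun i j k hij hik hjk => ?_⟩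
  exact (hr.2 _ _ _ (fun h => hij (h1 _ _ h)) (fun h => hik (h1 _ _ h))
    (fun h => hjk (h1 _ _ h))).not.2 (h2 i j k hij hik hjk)

/-- In a realization of the Fano plane, the meet of two lines spanned by points of the
realization is the image of the corresponding point of the Fano plane. -/
theorem IsFano.eq_of_mem {r : ZMod 7 → Pl.Point} (hr : Pl.IsFano r) {i j k l : ZMod 7}
    (hij : i ≠ j) (hkl : k ≠ l) (hm : fanoThird i j = fanoThird k l)
    (hik : i ≠ k) (hjk : j ≠ k) (hk : k ≠ fanoThird i j)
    {s t : Set Pl.Point} (hs : s ∈ Pl.L) (ht : t ∈ Pl.L) (his : r i ∈ s) (hjs : r j ∈ s)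
    (hkt : r k ∈ t) (hlt : r l ∈ t) {x : Pl.Point} (hxs : x ∈ s) (hxt : x ∈ t) :
    x = r (fanoThird i j) := by
  have mem {i j : ZMod 7} (hij : i ≠ j) {s : Set Pl.Point} (hs : s ∈ Pl.L) (his : r i ∈ s)
      (hjs : r j ∈ s) : r (fanoThird i j) ∈ s := by
    obtain ⟨u, hu, hiu, hju, hmu⟩ := collinear_triple_iff.1
      ((hr.2 i j _ hij (fanoThird_ne_left i j hij) (fanoThird_ne_right i j hij)).2 rfl)
    rcases eq_or_eq_of_mem hs hu his hjs hiu hju with h | rfl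
    · exact absurd (hr.1 h) hij
    · exact hmu
  rcases eq_or_eq_of_mem hs ht hxs (mem hij hs his hjs) hxt (hm ▸ mem hkl ht hkt hlt) with h | rfl
  · exact h
  · exact absurd ((hr.2 i j k hij hik hjk).1 (collinear_triple_iff.2 ⟨s, hs, his, hjs, hkt⟩)) hk

/-- The diagonal points of the quadrangle `r 2, r 4, r 5, r 6` in a realization of the Fano
plane. -/
theorem IsFano.diagonal_points {r : ZMod 7 → Pl.Point} (hr : Pl.IsFano r)
    {lab lcd lac lbd lad lbc : Set Pl.Point}
    (hlab : lab ∈ Pl.L) (hab : r 2 ∈ lab) (hba : r 4 ∈ lab)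
    (hlcd : lcd ∈ Pl.L) (hcd : r 5 ∈ lcd) (hdc : r 6 ∈ lcd)
    (hlac : lac ∈ Pl.L) (hac : r 2 ∈ lac) (hca : r 5 ∈ lac)
    (hlbd : lbd ∈ Pl.L) (hbd : r 4 ∈ lbd) (hdb : r 6 ∈ lbd)
    (hlad : lad ∈ Pl.L) (had : r 2 ∈ lad) (hda : r 6 ∈ lad)
    (hlbc : lbc ∈ Pl.L) (hbc : r 4 ∈ lbc) (hcb : r 5 ∈ lbc) {x y z : Pl.Point}
    (hxab : x ∈ lab) (hxcd : x ∈ lcd) (hyac : y ∈ lac) (hybd : y ∈ lbd)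
    (hzad : z ∈ lad) (hzbc : z ∈ lbc) : x = r 1 ∧ y = r 3 ∧ z = r 0 := by
  refine ⟨?_, ?_, ?_⟩
  · exact hr.eq_of_mem (i := 2) (j := 4) (k := 5) (l := 6) (by decide +kernel) (by decide +kernel)
      (by decide +kernel) (by decide +kernel) (by decide +kernel) (by decide +kernel)
      hlab hlcd hab hba hcd hdc hxab hxcd
  · exact hr.eq_of_mem (i := 2) (j := 5) (k := 4) (l := 6) (by decide +kernel) (by decide +kernel)
      (by decide +kernel) (by decide +kernel) (by decide +kernel) (by decide +kernel)
      hlac hlbd hac hca hbd hdb hyac hybd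
  · exact hr.eq_of_mem (i := 2) (j := 6) (k := 4) (l := 5) (by decide +kernel) (by decide +kernel)
      (by decide +kernel) (by decide +kernel) (by decide +kernel) (by decide +kernel)
      hlad hlbc had hda hbc hcb hzad hzbc

/-- A family of points and lines with the incidences of the Fano plane, and no others, is a
realization of the Fano plane. -/
theorem isFano_of_incidence {r : ZMod 7 → Pl.Point} {l : ZMod 7 → Set Pl.Point}
    (hl : ∀ a, l a ∈ Pl.L) (h : ∀ i a, r i ∈ l a ↔ i = a ∨ i = a + 1 ∨ i = a + 3) :
    Pl.IsFano r := by
  have hinj : Function.Injective r := by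
    have key : ∀ i j : ZMod 7, (∀ a : ZMod 7, (i = a ∨ i = a + 1 ∨ i = a + 3) ↔
        (j = a ∨ j = a + 1 ∨ j = a + 3)) → i = j := by
      decide +kernel
    intro i j hij
    exact key i j fun a => by rw [← h, ← h, hij]
  refine ⟨hinj, fun i j k hij hik hjk => ?_⟩
  have key : ∀ i j : ZMod 7, i ≠ j → ∃ a : ZMod 7, (i = a ∨ i = a + 1 ∨ i = a + 3) ∧
      (j = a ∨ j = a + 1 ∨ j = a + 3) ∧ ∀ k : ZMod 7, i ≠ k → j ≠ k →
        ((k = a ∨ k = a + 1 ∨ k = a + 3) ↔ k = fanoThird i j) := by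
    decide +kernel
  obtain ⟨a, hi, hj, hk⟩ := key i j hij
  rw [← h] at hi hj
  rw [← hk k hik hjk, ← h, collinear_triple_iff]
  constructor
  · rintro ⟨m, hm, him, hjm, hkm⟩
    rcases eq_or_eq_of_mem (hl a) hm hi hj him hjm with e | e
    · exact absurd (hinj e) hij
    · exact e ▸ hkm
  · exact fun hka => ⟨l a, hl a, hi, hj, hka⟩

theorem IsArc4.exists_lines {p : Fin 4 → Pl.Point} (hp : Pl.IsArc4 p) :
    ∃ l : Fin 4 → Fin 4 → Set Pl.Point, ∀ i j, i ≠ j → l i j ∈ Pl.L ∧ p i ∈ l i j ∧ p j ∈ l i j ∧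
      ∀ k, k ≠ i → k ≠ j → p k ∉ l i j := by
  have (i j : Fin 4) : ∃ s : Set Pl.Point, i ≠ j → s ∈ Pl.L ∧ p i ∈ s ∧ p j ∈ s ∧
      ∀ k, k ≠ i → k ≠ j → p k ∉ s := by
    by_cases hij : i = j
    · exact ⟨∅, fun h => absurd hij h⟩
    · obtain ⟨s, hs, hi, hj⟩ := exists_line (hp.1.ne hij)
      exact ⟨s, fun _ => ⟨hs, hi, hj, fun k hki hkj hk =>
        hp.2 i j k hij hki.symm hkj.symm (collinear_triple_iff.2 ⟨s, hs, hi, hj, hk⟩)⟩⟩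
  choose l hl using this
  exact ⟨l, hl⟩

/-- If the Fano axiom holds, then every quadrangle extends to a Fano subplane. -/
theorem FanoAxiom.exists_isFano (hF : Pl.FanoAxiom) {p : Fin 4 → Pl.Point} (hp : Pl.IsArc4 p) :
    ∃ r, Pl.IsFano r ∧ r ∘ ![2, 4, 5, 6] = p := by
  obtain ⟨l, hl⟩ := hp.exists_lines
  obtain ⟨ab, hab1, hab2, hab3⟩ := hl 0 1 (by decide)
  obtain ⟨cd, hcd1, hcd2, hcd3⟩ := hl 2 3 (by decide)
  obtain ⟨ac, hac1, hac2, hac3⟩ := hl 0 2 (by decide)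
  obtain ⟨bd, hbd1, hbd2, hbd3⟩ := hl 1 3 (by decide)
  obtain ⟨ad, had1, had2, had3⟩ := hl 0 3 (by decide)
  obtain ⟨bc, hbc1, hbc2, hbc3⟩ := hl 1 2 (by decide)
  have c_ab := hab3 2 (by decide) (by decide)
  have d_ab := hab3 3 (by decide) (by decide)
  have a_cd := hcd3 0 (by decide) (by decide)
  have b_cd := hcd3 1 (by decide) (by decide)
  have b_ac := hac3 1 (by decide) (by decide)
  have d_ac := hac3 3 (by decide) (by decide)
  have a_bd := hbd3 0 (by decide) (by decide)
  have c_bd := hbd3 2 (by decide) (by decide)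
  have b_ad := had3 1 (by decide) (by decide)
  have c_ad := had3 2 (by decide) (by decide)
  have a_bc := hbc3 0 (by decide) (by decide)
  have d_bc := hbc3 3 (by decide) (by decide)
  clear hab3 hcd3 hac3 hbd3 had3 hbc3
  obtain ⟨e, he1, he2⟩ := exists_mem_inter ab cd fun h => a_cd (h ▸ hab1)
  obtain ⟨f, hf1, hf2⟩ := exists_mem_inter ac bd fun h => a_bd (h ▸ hac1)
  obtain ⟨g, hg1, hg2⟩ := exists_mem_inter ad bc fun h => a_bc (h ▸ had1)
  obtain ⟨m, hm, hem, hfm, hgm⟩ := collinear_triple_iff.1 <|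
    hF (p 0) (p 1) (p 2) (p 3) (hp.1.ne (by decide)) (hp.1.ne (by decide)) (hp.1.ne (by decide))
      (hp.1.ne (by decide)) (hp.1.ne (by decide)) (hp.1.ne (by decide))
      (hp.2 _ _ _ (by decide) (by decide) (by decide))
      (hp.2 _ _ _ (by decide) (by decide) (by decide))
      (hp.2 _ _ _ (by decide) (by decide) (by decide))
      (hp.2 _ _ _ (by decide) (by decide) (by decide))
      _ _ _ _ _ _ ab hab1 hab2 cd hcd1 hcd2 ac hac1 hac2 bd hbd1 hbd2 ad had1 had2 bc hbc1 hbc2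
      e f g he1 he2 hf1 hf2 hg1 hg2
  have not_mem {x y : Pl.Point} {s t : Set Pl.Point} (hs : s ∈ Pl.L) (ht : t ∈ Pl.L)
      (hxs : x ∈ s) (hxt : x ∈ t) (hys : y ∈ s) (hne : x ≠ y) (hst : s ≠ t) : y ∉ t :=
    fun hyt => (eq_or_eq_of_mem hs ht hxs hys hxt hyt).elim hne hst
  have e_ac : e ∉ l 0 2 := not_mem ab ac hab1 hac1 he1 (by grind) (by grind)
  have e_bd : e ∉ l 1 3 := not_mem ab bd hab2 hbd1 he1 (by grind) (by grind)
  have e_ad : e ∉ l 0 3 := not_mem ab ad hab1 had1 he1 (by grind) (by grind)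
  have e_bc : e ∉ l 1 2 := not_mem ab bc hab2 hbc1 he1 (by grind) (by grind)
  have f_ab : f ∉ l 0 1 := not_mem ac ab hac1 hab1 hf1 (by grind) (by grind)
  have f_cd : f ∉ l 2 3 := not_mem ac cd hac2 hcd1 hf1 (by grind) (by grind)
  have f_ad : f ∉ l 0 3 := not_mem ac ad hac1 had1 hf1 (by grind) (by grind)
  have f_bc : f ∉ l 1 2 := not_mem ac bc hac2 hbc2 hf1 (by grind) (by grind)
  have g_ab : g ∉ l 0 1 := not_mem ad ab had1 hab1 hg1 (by grind) (by grind)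
  have g_cd : g ∉ l 2 3 := not_mem ad cd had2 hcd2 hg1 (by grind) (by grind)
  have g_ac : g ∉ l 0 2 := not_mem ad ac had1 hac1 hg1 (by grind) (by grind)
  have g_bd : g ∉ l 1 3 := not_mem ad bd had2 hbd2 hg1 (by grind) (by grind)
  have a_m : p 0 ∉ m := not_mem ab hm he1 hem hab1 (by grind) (by grind)
  have b_m : p 1 ∉ m := not_mem ab hm he1 hem hab2 (by grind) (by grind)
  have c_m : p 2 ∉ m := not_mem cd hm he2 hem hcd1 (by grind) (by grind)
  have d_m : p 3 ∉ m := not_mem cd hm he2 hem hcd2 (by grind) (by grind)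
  let r : ZMod 7 → Pl.Point := ![g, e, p 0, f, p 1, p 2, p 3]
  let n : ZMod 7 → Set Pl.Point := ![m, l 0 1, l 0 2, l 1 3, l 1 2, l 2 3, l 0 3]
  refine ⟨r, isFano_of_incidence (l := n) (fun a => ?_) (fun i a => ?_), funext fun i => ?_⟩
  · fin_cases a <;> assumption
  · rw [← decide_eq_true_iff (p := i = a ∨ i = a + 1 ∨ i = a + 3)]
    cases hia : decide (i = a ∨ i = a + 1 ∨ i = a + 3)
    · refine iff_of_false ?_ Bool.false_ne_true
      fin_cases i <;> fin_cases a <;>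
        first | assumption | exact absurd hia (by decide +kernel)
    · refine iff_of_true ?_ rfl
      fin_cases i <;> fin_cases a <;>
        first | assumption | exact absurd hia (by decide +kernel)
  · fin_cases i <;> rfl

variable (Pl) in
/-- The quadrangle formed by the complement of the line `{0, 1, 3}`. -/
def fanoQuadrangle (r : {r : ZMod 7 → Pl.Point // Pl.IsFano r}) :
    {p : Fin 4 → Pl.Point // Pl.IsArc4 p} :=
  ⟨r.1 ∘ ![2, 4, 5, 6], r.2.isArc4⟩

theorem fanoQuadrangle_injective : Function.Injective Pl.fanoQuadrangle := by
  rintro ⟨r, hr⟩ ⟨r', hr'⟩ h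
  have h (i : Fin 4) := congrFun (congrArg Subtype.val h) i
  have h2 : r 2 = r' 2 := h 0
  have h4 : r 4 = r' 4 := h 1
  have h5 : r 5 = r' 5 := h 2
  have h6 : r 6 = r' 6 := h 3
  have mem (i j k : ZMod 7) (hij : i ≠ j) (hik : i ≠ k) (hjk : j ≠ k) (hk : k = fanoThird i j) :=
    collinear_triple_iff.1 ((hr.2 i j k hij hik hjk).2 hk)
  obtain ⟨ab, hab, hab1, hab2, hab3⟩ := mem 2 4 1 (by decide +kernel) (by decide +kernel)
    (by decide +kernel) (by decide +kernel)
  obtain ⟨cd, hcd, hcd1, hcd2, hcd3⟩ := mem 5 6 1 (by decide +kernel) (by decide +kernel)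
    (by decide +kernel) (by decide +kernel)
  obtain ⟨ac, hac, hac1, hac2, hac3⟩ := mem 2 5 3 (by decide +kernel) (by decide +kernel)
    (by decide +kernel) (by decide +kernel)
  obtain ⟨bd, hbd, hbd1, hbd2, hbd3⟩ := mem 4 6 3 (by decide +kernel) (by decide +kernel)
    (by decide +kernel) (by decide +kernel)
  obtain ⟨ad, had, had1, had2, had3⟩ := mem 2 6 0 (by decide +kernel) (by decide +kernel)
    (by decide +kernel) (by decide +kernel)
  obtain ⟨bc, hbc, hbc1, hbc2, hbc3⟩ := mem 4 5 0 (by decide +kernel) (by decide +kernel)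
    (by decide +kernel) (by decide +kernel)
  rw [h2] at hab1 hac1 had1
  rw [h4] at hab2 hbd1 hbc1
  rw [h5] at hcd1 hac2 hbc2
  rw [h6] at hcd2 hbd2 had2
  obtain ⟨h1, h3, h0⟩ := hr'.diagonal_points hab hab1 hab2 hcd hcd1 hcd2 hac hac1 hac2
    hbd hbd1 hbd2 had had1 had2 hbc hbc1 hbc2 hab3 hcd3 hac3 hbd3 had3 hbc3
  refine Subtype.ext (funext fun i => ?_)
  fin_cases i
  exacts [h0, h1, h2, h3, h4, h5, h6]

theorem fanoAxiom_of_surjective (h : Function.Surjective Pl.fanoQuadrangle) : Pl.FanoAxiom := by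
  intro a b c d hab hac had hbc hbd hcd nabc nabd nacd nbcd lab lcd lac lbd lad lbc
    hlab ab ba hlcd cd dc hlac ac ca hlbd bd db hlad ad da hlbc bc cb x y z
    hx1 hx2 hy1 hy2 hz1 hz2
  have hp : Pl.IsArc4 ![a, b, c, d] := by
    have perm {x y z : Pl.Point} : (Pl.Collinear {x, y, z} → Pl.Collinear {y, x, z}) ∧
        (Pl.Collinear {x, y, z} → Pl.Collinear {x, z, y}) := by
      simp only [collinear_triple_iff]
      exact ⟨fun ⟨l, h⟩ => ⟨l, by tauto⟩, fun ⟨l, h⟩ => ⟨l, by tauto⟩⟩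
    constructor
    · intro i j hij
      fin_cases i <;> fin_cases j <;> simp_all
    · intro i j k hij hik hjk
      fin_cases i <;> fin_cases j <;> fin_cases k <;>
        first
        | exact absurd rfl hij
        | exact absurd rfl hik
        | exact absurd rfl hjk
        | (simp; grind)
  obtain ⟨⟨r, hr⟩, hrp⟩ := h ⟨_, hp⟩
  have hrp (i : Fin 4) := congrFun (congrArg Subtype.val hrp) i
  obtain rfl : r 2 = a := hrp 0
  obtain rfl : r 4 = b := hrp 1
  obtain rfl : r 5 = c := hrp 2
  obtain rfl : r 6 = d := hrp 3
  obtain ⟨rfl, rfl, rfl⟩ := hr.diagonal_points hlab ab ba hlcd cd dc hlac ac ca hlbd bd db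
    hlad ad da hlbc bc cb hx1 hx2 hy1 hy2 hz1 hz2
  exact (hr.2 1 3 0 (by decide +kernel) (by decide +kernel) (by decide +kernel)).2
    (by decide +kernel)

theorem FanoAxiom.surjective_fanoQuadrangle (hF : Pl.FanoAxiom) :
    Function.Surjective Pl.fanoQuadrangle := fun ⟨_, hp⟩ =>
  let ⟨r, hr, h⟩ := hF.exists_isFano hp
  ⟨⟨r, hr⟩, Subtype.ext h⟩

end ProjPlane

/-- If a finite projective plane obeys the Fano axiom then `A₇ = 30·C₄`, and
otherwise `A₇ < 30·C₄`. -/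
theorem A7_eq_or_lt_thirty_C4 (q : ℕ) (Pl : ProjPlane q) :
    (Pl.FanoAxiom → Pl.A7 = 30 * Pl.nArcs 4) ∧
    (¬ Pl.FanoAxiom → Pl.A7 < 30 * Pl.nArcs 4) := by
  have hC : Pl.nArcs 4 = Nat.card {p : Fin 4 → Pl.Point // Pl.IsArc4 p} := rfl
  have := Pl.fintypePoint
  rw [Pl.A7_eq_thirty_mul, hC]
  constructor
  · intro hF
    rw [Nat.card_eq_of_bijective _
      ⟨ProjPlane.fanoQuadrangle_injective, hF.surjective_fanoQuadrangle⟩]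
  · intro hF
    refine Nat.mul_lt_mul_of_pos_left ?_ (by norm_num)
    rw [Nat.card_eq_fintype_card, Nat.card_eq_fintype_card]
    exact Fintype.card_lt_of_injective_not_surjective _ ProjPlane.fanoQuadrangle_injective
      fun h => hF (ProjPlane.fanoAxiom_of_surjective h)
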